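/- Let K ≥ 2, let α ∈ ℝ^K with α_k > 0 for all k, let α_0 = Σ_k α_k, and let i ≠ j be indices in {1,…,K}. Then: (a) ∫_Δ θ_i² · (θ_i/(θ_i+θ_j)) · D_α(θ) dθ = [α_i(α_i+1)(α_i+2) / (α_0(α_0+1)(α_i+α_j+2))] · ∫_Δ D_α(θ) dθ; (b) ∫_Δ θ_j² · (θ_i/(θ_i+θ_j)) · D_α(θ) dθ = [α_i α_j(α_j+1) / (α_0(α_0+1)(α_i+α_j+2))] · ∫_Δ D_α(θ) dθ; (c) for every index k with k ≠ i and k ≠ j, ∫_Δ θ_k² · (θ_i/(θ_i+θ_j)) · D_α(θ) dθ = [α_k(α_k+1) α_i / (α_0(α_0+1)(α_i+α_j))] · ∫_Δ D_α(θ) dθ. -/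

import Mathlib

open MeasureTheory Finset

/-- The Beta function `B(a,b) = ∫_0^1 t^(a-1) (1-t)^(b-1) dt`. -/
noncomputable def betaFun (a b : ℝ) : ℝ :=
  ∫ t in Set.Ioo (0:ℝ) 1, t ^ (a - 1) * (1 - t) ^ (b - 1)

/-- The regularized incomplete beta function evaluated at `1/2`. -/
noncomputable def Ihalf (a b : ℝ) : ℝ :=
  (∫ t in Set.Ioo (0:ℝ) (1/2), t ^ (a - 1) * (1 - t) ^ (b - 1)) / betaFun a b

/-- The parametrizing domain `{y ∈ ℝ^{K-1} : y_k > 0, Σ y_k < 1}` of the open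
probability simplex on `K` coordinates. -/
def simplexDomain (K : ℕ) : Set (Fin (K - 1) → ℝ) :=
  {y | (∀ k, 0 < y k) ∧ ∑ k, y k < 1}

/-- The point of the simplex with coordinates `θ_k = y_k` for `k < K-1` and
`θ_K = 1 - Σ y_k`. -/
noncomputable def coordsOf {K : ℕ} (y : Fin (K - 1) → ℝ) : Fin K → ℝ :=
  fun i => if h : (i : ℕ) < K - 1 then y ⟨(i : ℕ), h⟩ else 1 - ∑ k, y k

/-- `∫_Δ f(θ) dθ`, the integral of `f` over the open probability simplex via the
standard parametrization. -/
noncomputable def simplexIntegral (K : ℕ) (f : (Fin K → ℝ) → ℝ) : ℝ :=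
  ∫ y in simplexDomain K, f (coordsOf y)

/-- The unnormalized Dirichlet density `D_α(θ) = ∏ θ_k^(α_k - 1)`. -/
noncomputable def dirDensity {K : ℕ} (α : Fin K → ℝ) (θ : Fin K → ℝ) : ℝ :=
  ∏ k, θ k ^ (α k - 1)

open scoped ENNReal

theorem lintegral_prod_eq_prod_lintegral_fin {n : ℕ} (f : Fin n → ℝ → ℝ≥0∞)
    (hf : ∀ k, Measurable (f k)) :
    ∫⁻ x : Fin n → ℝ, ∏ k, f k (x k) = ∏ k, ∫⁻ t, f k t := by
  induction n with
  | zero => simp [lintegral_unique, Measure.volume_pi_eq_dirac (0 : Fin 0 → ℝ)]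
  | succ n ih =>
    have e := (volume_preserving_piFinSuccAbove (fun _ : Fin (n + 1) => ℝ) 0).symm
    rw [e.lintegral_map_equiv, Measure.volume_eq_prod, Fin.prod_univ_succ]
    simp only [Fin.prod_univ_succ, MeasurableEquiv.piFinSuccAbove_symm_apply,
      Fin.insertNthEquiv_zero, Fin.consEquiv_apply, Fin.cons_zero, Fin.cons_succ]
    rw [lintegral_prod_mul (f := f 0) (g := fun x : Fin n → ℝ => ∏ k, f k.succ (x k))
      (hf 0).aemeasurable (Finset.measurable_fun_prod _ fun k _ =>
        (hf k.succ).comp (measurable_pi_apply k)).aemeasurable, ih _ fun k => hf k.succ]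

theorem coordsOf_eq_snoc {n : ℕ} (y : Fin n → ℝ) :
    coordsOf (K := n + 1) y = Fin.snoc (α := fun _ => ℝ) y (1 - ∑ k, y k) := by
  funext k
  refine Fin.lastCases ?_ (fun k => ?_) k
  · simp [coordsOf]
  · simp [coordsOf]

theorem sum_coordsOf {n : ℕ} (y : Fin n → ℝ) : ∑ k, coordsOf (K := n + 1) y k = 1 := by
  simp [coordsOf_eq_snoc, Fin.sum_univ_castSucc]

theorem coordsOf_pos_iff {n : ℕ} (y : Fin n → ℝ) :
    (∀ k, 0 < coordsOf (K := n + 1) y k) ↔ y ∈ simplexDomain (n + 1) := by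
  simp [coordsOf_eq_snoc, Fin.forall_fin_succ', simplexDomain]

theorem measurable_coordsOf (K : ℕ) : Measurable (coordsOf (K := K)) := by
  refine measurable_pi_lambda _ fun k => ?_
  unfold coordsOf
  split_ifs <;> fun_prop

theorem measurableSet_simplexDomain (K : ℕ) : MeasurableSet (simplexDomain K) := by
  unfold simplexDomain
  measurability

theorem lintegral_comp_smul_pi {n : ℕ} (f : (Fin n → ℝ) → ℝ≥0∞) {s : ℝ} (hs : 0 < s) :
    ∫⁻ x, f x = ENNReal.ofReal (s ^ n) * ∫⁻ x, f (s • x) := by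
  have h := Measure.map_addHaar_smul (volume : Measure (Fin n → ℝ)) hs.ne'
  have e : ∫⁻ x, f (s • x) = ∫⁻ x, f x ∂(Measure.map (s • ·) volume) :=
    (lintegral_map_equiv f (MeasurableEquiv.smul₀ s hs.ne')).symm
  rw [e, h, lintegral_smul_measure, smul_eq_mul, ← mul_assoc, ← ENNReal.ofReal_mul (by positivity),
    Module.finrank_fin_fun, abs_of_pos (by positivity), mul_inv_cancel₀ (by positivity)]
  simp

/-- Integration over the positive orthant in the coordinates `x = s • θ`, where `s > 0` and `θ`
runs over the open probability simplex. -/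
theorem lintegral_orthant_eq {n : ℕ} (H : (Fin (n + 1) → ℝ) → ℝ≥0∞) (hH : Measurable H)
    (hpos : ∀ x, H x ≠ 0 → ∀ k, 0 < x k) :
    ∫⁻ x, H x = ∫⁻ s in Set.Ioi (0 : ℝ), ENNReal.ofReal (s ^ n) *
      ∫⁻ y in simplexDomain (n + 1), H (s • coordsOf y) := by
  have e := (volume_preserving_piFinSuccAbove (fun _ : Fin (n + 1) => ℝ) (Fin.last n)).symm
  have hsnoc : Measurable fun p : ℝ × (Fin n → ℝ) => Fin.snoc (α := fun _ => ℝ) p.2 p.1 := by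
    refine measurable_pi_lambda _ fun k => ?_
    refine Fin.lastCases ?_ (fun k => ?_) k <;> simp <;> fun_prop
  have h₁ : ∫⁻ x, H x = ∫⁻ y : Fin n → ℝ, ∫⁻ t : ℝ, H (Fin.snoc (α := fun _ => ℝ) y t) := by
    rw [e.lintegral_map_equiv, Measure.volume_eq_prod, lintegral_prod_symm']
    · simp
      rfl
    · exact hH.comp (MeasurableEquiv.measurable _)
  have h₂ (y : Fin n → ℝ) : ∫⁻ t : ℝ, H (Fin.snoc (α := fun _ => ℝ) y t) =
      ∫⁻ s : ℝ, H (Fin.snoc (α := fun _ => ℝ) y (s - ∑ k, y k)) :=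
    (lintegral_sub_right_eq_self (fun t => H (Fin.snoc (α := fun _ => ℝ) y t)) _).symm
  simp_rw [h₁, h₂]
  rw [lintegral_lintegral_swap]
  swap
  · exact (hH.comp (hsnoc.comp (f := fun q : (Fin n → ℝ) × ℝ => (q.2 - ∑ k, q.1 k, q.1))
      (by fun_prop))).aemeasurable
  rw [← lintegral_indicator measurableSet_Ioi]
  refine lintegral_congr fun s => ?_
  by_cases hs : 0 < s
  · rw [Set.indicator_of_mem (Set.mem_Ioi.2 hs), lintegral_comp_smul_pi _ hs,
      ← lintegral_indicator (measurableSet_simplexDomain (n + 1))]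
    congr 1
    refine lintegral_congr fun y => ?_
    have hy : Fin.snoc (α := fun _ => ℝ) (s • y) (s - ∑ k, (s • y) k) =
        s • coordsOf (K := n + 1) y := by
      rw [coordsOf_eq_snoc]
      funext k
      refine Fin.lastCases ?_ (fun k => ?_) k
      · simp [mul_sub, Finset.mul_sum]
      · simp
    rw [hy]
    symm
    rw [Set.indicator_apply_eq_self]
    intro hy'
    by_contra h
    refine hy' ((coordsOf_pos_iff y).1 fun k => ?_)
    have := hpos _ h k
    rw [Pi.smul_apply, smul_eq_mul] at this
    exact pos_of_mul_pos_right this hs.le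
  · rw [Set.indicator_of_notMem (by simpa using hs)]
    refine (lintegral_congr fun y => ?_).trans lintegral_zero
    by_contra h
    have := hpos _ h
    refine hs ?_
    have hsum : s = ∑ k, Fin.snoc (α := fun _ => ℝ) y (s - ∑ k, y k) k := by
      simp [Fin.sum_univ_castSucc]
    rw [hsum]
    exact Finset.sum_pos (fun k _ => this k) univ_nonempty

/-- The unnormalized Gamma density with shape `a` and rate `r`, extended by zero. -/
noncomputable def gammaKernel (a r x : ℝ) : ℝ≥0∞ :=
  if 0 < x then ENNReal.ofReal (x ^ (a - 1) * Real.exp (-(r * x))) else 0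

theorem measurable_gammaKernel (a : ℝ) : Measurable fun p : ℝ × ℝ => gammaKernel a p.1 p.2 := by
  unfold gammaKernel
  exact Measurable.ite (measurableSet_lt measurable_const measurable_snd) (by fun_prop)
    measurable_const

theorem lintegral_Ioi_rpow_mul_exp {a r : ℝ} (ha : 0 < a) (hr : 0 < r) :
    ∫⁻ x in Set.Ioi (0 : ℝ), ENNReal.ofReal (x ^ (a - 1) * Real.exp (-(r * x))) =
      ENNReal.ofReal ((1 / r) ^ a * Real.Gamma a) := by
  rw [← Real.integral_rpow_mul_exp_neg_mul_Ioi ha hr, ofReal_integral_eq_lintegral_ofReal]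
  · have := integrableOn_rpow_mul_exp_neg_mul_rpow (p := 1) (s := a - 1) (b := r) (by linarith)
      one_pos hr
    simpa [IntegrableOn] using this
  · filter_upwards [ae_restrict_mem measurableSet_Ioi] with x hx
    have := Set.mem_Ioi.1 hx
    positivity

theorem lintegral_gammaKernel {a r : ℝ} (ha : 0 < a) (hr : 0 < r) :
    ∫⁻ x, gammaKernel a r x = ENNReal.ofReal ((1 / r) ^ a * Real.Gamma a) := by
  rw [← lintegral_Ioi_rpow_mul_exp ha hr, ← lintegral_indicator measurableSet_Ioi]
  rfl

theorem gammaKernel_eq_mul_exp (a r x : ℝ) :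
    gammaKernel a r x = gammaKernel a 1 x * ENNReal.ofReal (Real.exp (-((r - 1) * x))) := by
  unfold gammaKernel
  split_ifs with hx
  · rw [← ENNReal.ofReal_mul (by positivity), mul_assoc, ← Real.exp_add]
    ring_nf
  · simp

theorem pos_of_prod_gammaKernel_ne_zero {K : ℕ} {β r x : Fin K → ℝ}
    (h : ∏ k, gammaKernel (β k) (r k) (x k) ≠ 0) (k : Fin K) : 0 < x k := by
  by_contra hk
  exact h (Finset.prod_eq_zero (Finset.mem_univ k) (if_neg hk))

theorem dirDensity_pos {K : ℕ} (β : Fin K → ℝ) {x : Fin K → ℝ} (hx : ∀ k, 0 < x k) :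
    0 < dirDensity β x :=
  Finset.prod_pos fun k _ => Real.rpow_pos_of_pos (hx k) _

theorem measurable_dirDensity {K : ℕ} (β : Fin K → ℝ) : Measurable (dirDensity β) := by
  unfold dirDensity
  fun_prop

theorem prod_gammaKernel_one {K : ℕ} (β : Fin K → ℝ) {x : Fin K → ℝ} (hx : ∀ k, 0 < x k) :
    ∏ k, gammaKernel (β k) 1 (x k) =
      ENNReal.ofReal (dirDensity β x * Real.exp (-∑ k, x k)) := by
  rw [dirDensity, ← Finset.sum_neg_distrib, Real.exp_sum, ← Finset.prod_mul_distrib,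
    ENNReal.ofReal_prod_of_nonneg fun k _ =>
      mul_nonneg (Real.rpow_nonneg (hx k).le _) (Real.exp_nonneg _)]
  exact Finset.prod_congr rfl fun k _ => by simp [gammaKernel, hx k]

theorem dirDensity_smul {K : ℕ} (β : Fin K → ℝ) {x : Fin K → ℝ} (hx : ∀ k, 0 < x k)
    {s : ℝ} (hs : 0 < s) :
    dirDensity β (s • x) = s ^ (∑ k, β k - K) * dirDensity β x := by
  have h : ∑ k, β k - K = ∑ k, (β k - 1) := by simp
  rw [h, Real.rpow_sum_of_pos hs, dirDensity, dirDensity, ← Finset.prod_mul_distrib]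
  exact Finset.prod_congr rfl fun k _ => by
    rw [Pi.smul_apply, smul_eq_mul, Real.mul_rpow hs.le (hx k).le]

theorem lintegral_orthant_of_homogeneous {n : ℕ} (H : (Fin (n + 1) → ℝ) → ℝ≥0∞)
    (hH : Measurable H) (hpos : ∀ x, H x ≠ 0 → ∀ k, 0 < x k) (F : (Fin (n + 1) → ℝ) → ℝ≥0∞)
    {c : ℝ} (hc : 0 < c)
    (hhom : ∀ s > 0, ∀ y ∈ simplexDomain (n + 1), H (s • coordsOf y) =
      ENNReal.ofReal (s ^ (c - (n + 1)) * Real.exp (-s)) * F (coordsOf y)) :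
    ∫⁻ x, H x =
      ENNReal.ofReal (Real.Gamma c) * ∫⁻ y in simplexDomain (n + 1), F (coordsOf y) := by
  have hΓ := lintegral_Ioi_rpow_mul_exp hc one_pos
  rw [div_one, Real.one_rpow, one_mul] at hΓ
  rw [lintegral_orthant_eq H hH hpos, ← hΓ, ← lintegral_mul_const _ (by fun_prop)]
  refine setLIntegral_congr_fun measurableSet_Ioi fun s hs => ?_
  have hs : 0 < s := hs
  rw [setLIntegral_congr_fun (measurableSet_simplexDomain _) (hhom s hs),
    lintegral_const_mul' _ _ ENNReal.ofReal_ne_top, ← mul_assoc,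
    ← ENNReal.ofReal_mul (by positivity), ← mul_assoc, ← Real.rpow_natCast, ← Real.rpow_add hs]
  ring_nf

theorem lintegral_simplex_dirDensity {n : ℕ} {β : Fin (n + 1) → ℝ} (hβ : ∀ k, 0 < β k) :
    ∫⁻ y in simplexDomain (n + 1), ENNReal.ofReal (dirDensity β (coordsOf y)) =
      ENNReal.ofReal ((∏ k, Real.Gamma (β k)) / Real.Gamma (∑ k, β k)) := by
  have hsum : 0 < ∑ k, β k := Finset.sum_pos (fun k _ => hβ k) univ_nonempty
  have hm (k) : Measurable (gammaKernel (β k) 1) :=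
    (measurable_gammaKernel (β k)).comp (measurable_const.prodMk measurable_id)
  have h := lintegral_orthant_of_homogeneous (fun x => ∏ k, gammaKernel (β k) 1 (x k))
    (Finset.measurable_fun_prod _ fun k _ => (hm k).comp (measurable_pi_apply k))
    (fun x hx => pos_of_prod_gammaKernel_ne_zero (r := 1) hx)
    (fun θ => ENNReal.ofReal (dirDensity β θ)) hsum (fun s hs y hy => by
      have hθ : ∀ k, 0 < coordsOf (K := n + 1) y k := (coordsOf_pos_iff y).2 hy
      rw [prod_gammaKernel_one β (x := s • coordsOf y) (fun k => mul_pos hs (hθ k)), dirDensity_smul β hθ hs,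
        ← ENNReal.ofReal_mul (by positivity)]
      simp only [Pi.smul_apply, smul_eq_mul, ← Finset.mul_sum, sum_coordsOf]
      push_cast
      ring_nf)
  rw [lintegral_prod_eq_prod_lintegral_fin _ hm,
    Finset.prod_congr rfl fun k _ => lintegral_gammaKernel (hβ k) one_pos,
    ← ENNReal.ofReal_prod_of_nonneg fun k _ => mul_nonneg (by simp)
      (Real.Gamma_pos_of_pos (hβ k)).le] at h
  rw [ENNReal.ofReal_div_of_pos (Real.Gamma_pos_of_pos hsum),
    ENNReal.eq_div_iff (by simpa using Real.Gamma_pos_of_pos hsum) ENNReal.ofReal_ne_top, ← h]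
  simp

theorem lintegral_Ioi_exp_neg_mul {b : ℝ} (hb : 0 < b) :
    ∫⁻ t in Set.Ioi (0 : ℝ), ENNReal.ofReal (Real.exp (-(b * t))) = ENNReal.ofReal (1 / b) := by
  simpa using lintegral_Ioi_rpow_mul_exp one_pos hb

theorem lintegral_Ioi_one_add_rpow_neg {b : ℝ} (hb : 1 < b) :
    ∫⁻ t in Set.Ioi (0 : ℝ), ENNReal.ofReal ((1 + t) ^ (-b)) = ENNReal.ofReal (1 / (b - 1)) := by
  have hval : ∫ t in Set.Ioi (0 : ℝ), (1 + t) ^ (-b) = 1 / (b - 1) := by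
    have h := (measurePreserving_add_left volume (1 : ℝ)).setIntegral_preimage_emb
      (measurableEmbedding_addLeft 1) (fun t => t ^ (-b)) (Set.Ioi 1)
    rw [Set.preimage_const_add_Ioi, sub_self] at h
    rw [h, integral_Ioi_rpow_of_lt (by linarith) one_pos, Real.one_rpow,
      ← neg_div_neg_eq]
    ring_nf
  rw [← hval, ofReal_integral_eq_lintegral_ofReal]
  · simpa [add_comm, IntegrableOn] using integrableOn_add_rpow_Ioi_of_lt (a := -b) (c := 0) (m := 1)
      (by linarith) (by norm_num)
  · filter_upwards [ae_restrict_mem measurableSet_Ioi] with t ht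
    have := Set.mem_Ioi.1 ht
    positivity

theorem lintegral_orthant_prod_gammaKernel_div {K : ℕ} {β : Fin K → ℝ} (hβ : ∀ k, 0 < β k)
    {i j : Fin K} (hij : i ≠ j) (hb : 1 < β i + β j) :
    ∫⁻ x : Fin K → ℝ, (∏ k, gammaKernel (β k) 1 (x k)) * ENNReal.ofReal (1 / (x i + x j)) =
      ENNReal.ofReal ((∏ k, Real.Gamma (β k)) / (β i + β j - 1)) := by
  set c : Fin K → ℝ := fun k => (if k = i then 1 else 0) + (if k = j then 1 else 0) with hc
  have hcsum (f : Fin K → ℝ) : ∑ k, c k * f k = f i + f j := by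
    simp [hc, add_mul, Finset.sum_add_distrib]
  have hc01 (k) : c k = 0 ∨ c k = 1 := by
    by_cases h₁ : k = i <;> by_cases h₂ : k = j <;> simp_all
  have hpt (x : Fin K → ℝ) :
      (∏ k, gammaKernel (β k) 1 (x k)) * ENNReal.ofReal (1 / (x i + x j)) =
        ∫⁻ t in Set.Ioi (0 : ℝ), ∏ k, gammaKernel (β k) (1 + c k * t) (x k) := by
    have hprod (t : ℝ) : ∏ k, gammaKernel (β k) (1 + c k * t) (x k) =
        (∏ k, gammaKernel (β k) 1 (x k)) *
          ENNReal.ofReal (Real.exp (-((x i + x j) * t))) := by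
      rw [← hcsum x, Finset.sum_mul, ← Finset.sum_neg_distrib, Real.exp_sum,
        ENNReal.ofReal_prod_of_nonneg fun k _ => Real.exp_nonneg _, ← Finset.prod_mul_distrib]
      refine Finset.prod_congr rfl fun k _ => ?_
      rw [gammaKernel_eq_mul_exp]
      ring_nf
    simp_rw [hprod]
    rw [lintegral_const_mul _ (by fun_prop)]
    by_cases h : ∏ k, gammaKernel (β k) 1 (x k) = 0
    · simp [h]
    · have hx := pos_of_prod_gammaKernel_ne_zero (r := 1) h
      rw [lintegral_Ioi_exp_neg_mul (add_pos (hx i) (hx j))]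
  simp_rw [hpt]
  rw [lintegral_lintegral_swap]
  swap
  · refine (Finset.measurable_fun_prod _ fun k _ => ?_).aemeasurable
    exact (measurable_gammaKernel (β k)).comp
      (f := fun q : (Fin K → ℝ) × ℝ => (1 + c k * q.2, q.1 k)) (by fun_prop)
  have hΓ : 0 ≤ ∏ k, Real.Gamma (β k) :=
    Finset.prod_nonneg fun k _ => (Real.Gamma_pos_of_pos (hβ k)).le
  rw [← mul_one_div, ENNReal.ofReal_mul hΓ, ← lintegral_Ioi_one_add_rpow_neg hb,
    ← lintegral_const_mul _ (by fun_prop)]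
  refine setLIntegral_congr_fun measurableSet_Ioi fun t ht => ?_
  have ht : 0 < t := ht
  have hr (k) : 0 < 1 + c k * t := by rcases hc01 k with h | h <;> rw [h] <;> linarith
  rw [lintegral_prod_eq_prod_lintegral_fin (fun k => gammaKernel (β k) (1 + c k * t)) fun k =>
      (measurable_gammaKernel (β k)).comp (measurable_const.prodMk measurable_id),
    Finset.prod_congr rfl fun k _ => lintegral_gammaKernel (hβ k) (hr k),
    ← ENNReal.ofReal_prod_of_nonneg fun k _ => mul_nonneg
      (Real.rpow_nonneg (one_div_nonneg.2 (hr k).le) _) (Real.Gamma_pos_of_pos (hβ k)).le,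
    Finset.prod_mul_distrib, mul_comm, ← ENNReal.ofReal_mul hΓ, ← hcsum β,
    ← Finset.sum_neg_distrib, Real.rpow_sum_of_pos (by linarith)]
  congr 2
  refine Finset.prod_congr rfl fun k _ => ?_
  rw [one_div, Real.inv_rpow (hr k).le, ← Real.rpow_neg (hr k).le]
  rcases hc01 k with h | h <;> simp [h]

theorem lintegral_simplex_dirDensity_div {n : ℕ} {β : Fin (n + 1) → ℝ} (hβ : ∀ k, 0 < β k)
    {i j : Fin (n + 1)} (hij : i ≠ j) (hb : 1 < β i + β j) :
    ∫⁻ y in simplexDomain (n + 1),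
        ENNReal.ofReal (dirDensity β (coordsOf y) / (coordsOf y i + coordsOf y j)) =
      ENNReal.ofReal ((∏ k, Real.Gamma (β k)) /
        ((β i + β j - 1) * Real.Gamma (∑ k, β k - 1))) := by
  have hsum : 0 < ∑ k, β k - 1 := by
    have := Finset.add_le_sum (fun k _ => (hβ k).le) (mem_univ i) (mem_univ j) hij
    linarith
  have h := lintegral_orthant_of_homogeneous
    (fun x => (∏ k, gammaKernel (β k) 1 (x k)) * ENNReal.ofReal (1 / (x i + x j)))
    ((Finset.measurable_fun_prod _ fun k _ => (measurable_gammaKernel (β k)).comp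
      (measurable_const.prodMk (measurable_pi_apply k))).mul (by fun_prop))
    (fun x hx => pos_of_prod_gammaKernel_ne_zero (r := 1) (left_ne_zero_of_mul hx))
    (fun θ => ENNReal.ofReal (dirDensity β θ / (θ i + θ j))) hsum (fun s hs y hy => by
      have hθ : ∀ k, 0 < coordsOf (K := n + 1) y k := (coordsOf_pos_iff y).2 hy
      have hD := dirDensity_pos β hθ
      rw [prod_gammaKernel_one β (x := s • coordsOf y) (fun k => mul_pos hs (hθ k)), dirDensity_smul β hθ hs,
        ← ENNReal.ofReal_mul (by positivity), ← ENNReal.ofReal_mul (by positivity)]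
      simp only [Pi.smul_apply, smul_eq_mul, ← Finset.mul_sum, sum_coordsOf, ← mul_add]
      have : ∑ k, β k - 1 - (n + 1) = (∑ k, β k - (n + 1)) - 1 := by ring
      rw [this, Real.rpow_sub_one hs.ne']
      push_cast
      field_simp)
  rw [lintegral_orthant_prod_gammaKernel_div hβ hij hb] at h
  rw [← div_div, ENNReal.ofReal_div_of_pos (Real.Gamma_pos_of_pos hsum),
    ENNReal.eq_div_iff (by simpa using Real.Gamma_pos_of_pos hsum) ENNReal.ofReal_ne_top, ← h]

theorem simplexIntegral_eq_of_lintegral {n : ℕ} {f : (Fin (n + 1) → ℝ) → ℝ} (hf : Measurable f)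
    (hf₀ : ∀ θ, (∀ k, 0 < θ k) → 0 ≤ f θ) {c : ℝ} (hc : 0 ≤ c)
    (h : ∫⁻ y in simplexDomain (n + 1), ENNReal.ofReal (f (coordsOf y)) = ENNReal.ofReal c) :
    simplexIntegral (n + 1) f = c := by
  rw [simplexIntegral, integral_eq_lintegral_of_nonneg_ae, h, ENNReal.toReal_ofReal hc]
  · filter_upwards [ae_restrict_mem (measurableSet_simplexDomain _)] with y hy
    exact hf₀ _ ((coordsOf_pos_iff y).2 hy)
  · exact (hf.comp (measurable_coordsOf _)).aestronglyMeasurable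

theorem simplexIntegral_congr {n : ℕ} {f g : (Fin (n + 1) → ℝ) → ℝ}
    (h : ∀ θ, (∀ k, 0 < θ k) → f θ = g θ) :
    simplexIntegral (n + 1) f = simplexIntegral (n + 1) g :=
  setIntegral_congr_fun (measurableSet_simplexDomain _) fun y hy =>
    h _ ((coordsOf_pos_iff y).2 hy)

theorem simplexIntegral_dirDensity {n : ℕ} {β : Fin (n + 1) → ℝ} (hβ : ∀ k, 0 < β k) :
    simplexIntegral (n + 1) (dirDensity β) =
      (∏ k, Real.Gamma (β k)) / Real.Gamma (∑ k, β k) :=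
  simplexIntegral_eq_of_lintegral (measurable_dirDensity β)
    (fun _ hθ => (dirDensity_pos β hθ).le)
    (div_nonneg (Finset.prod_nonneg fun k _ => (Real.Gamma_pos_of_pos (hβ k)).le)
      (Real.Gamma_pos_of_pos (Finset.sum_pos (fun k _ => hβ k) univ_nonempty)).le)
    (lintegral_simplex_dirDensity hβ)

theorem simplexIntegral_dirDensity_div {n : ℕ} {β : Fin (n + 1) → ℝ} (hβ : ∀ k, 0 < β k)
    {i j : Fin (n + 1)} (hij : i ≠ j) (hb : 1 < β i + β j) :
    simplexIntegral (n + 1) (fun θ => dirDensity β θ / (θ i + θ j)) =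
      (∏ k, Real.Gamma (β k)) / ((β i + β j - 1) * Real.Gamma (∑ k, β k - 1)) := by
  have hsum : 0 < ∑ k, β k - 1 := by
    have := Finset.add_le_sum (fun k _ => (hβ k).le) (mem_univ i) (mem_univ j) hij
    linarith
  refine simplexIntegral_eq_of_lintegral ((measurable_dirDensity β).div (by fun_prop))
    (fun θ hθ => div_nonneg (dirDensity_pos β hθ).le (add_pos (hθ i) (hθ j)).le)
    (div_nonneg (Finset.prod_nonneg fun k _ => (Real.Gamma_pos_of_pos (hβ k)).le)
      (mul_nonneg (by linarith) (Real.Gamma_pos_of_pos hsum).le))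
    (lintegral_simplex_dirDensity_div hβ hij hb)

theorem dirDensity_add_single {K : ℕ} (β : Fin K → ℝ) (i : Fin K) {θ : Fin K → ℝ}
    (hθ : ∀ k, 0 < θ k) : dirDensity (β + Pi.single i 1) θ = θ i * dirDensity β θ := by
  have h : θ i = ∏ k, θ k ^ (Pi.single i 1 : Fin K → ℝ) k := by
    rw [Finset.prod_eq_single i (fun k _ hk => by simp [hk]) (by simp)]
    simp
  rw [h, dirDensity, dirDensity, ← Finset.prod_mul_distrib]
  refine Finset.prod_congr rfl fun k _ => ?_
  rw [← Real.rpow_add (hθ k), Pi.add_apply]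
  ring_nf

theorem prod_Gamma_add_single {K : ℕ} {β : Fin K → ℝ} (hβ : ∀ k, 0 < β k) (i : Fin K) :
    ∏ k, Real.Gamma ((β + Pi.single i 1 : Fin K → ℝ) k) = β i * ∏ k, Real.Gamma (β k) := by
  rw [← Finset.mul_prod_erase _ _ (mem_univ i),
    ← Finset.mul_prod_erase univ (fun k => Real.Gamma (β k)) (mem_univ i), ← mul_assoc,
    ← Real.Gamma_add_one (hβ i).ne']
  congr 1
  · simp
  · exact Finset.prod_congr rfl fun k hk => by simp [Finset.ne_of_mem_erase hk]

theorem sum_add_single {K : ℕ} (β : Fin K → ℝ) (i : Fin K) :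
    ∑ k, (β + Pi.single i 1 : Fin K → ℝ) k = ∑ k, β k + 1 := by
  simp [Finset.sum_add_distrib]

theorem add_single_pos {K : ℕ} {β : Fin K → ℝ} (hβ : ∀ k, 0 < β k) (i k : Fin K) :
    0 < (β + Pi.single i 1 : Fin K → ℝ) k :=
  add_pos_of_pos_of_nonneg (hβ k) (by by_cases h : k = i <;> simp [h])

theorem simplexIntegral_dirDensity_add_single {n : ℕ} {β : Fin (n + 1) → ℝ} (hβ : ∀ k, 0 < β k)
    (i : Fin (n + 1)) :
    simplexIntegral (n + 1) (dirDensity (β + Pi.single i 1)) =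
      β i / (∑ k, β k) * simplexIntegral (n + 1) (dirDensity β) := by
  have hsum : 0 < ∑ k, β k := Finset.sum_pos (fun k _ => hβ k) univ_nonempty
  rw [simplexIntegral_dirDensity hβ, simplexIntegral_dirDensity (add_single_pos hβ i),
    prod_Gamma_add_single hβ, sum_add_single, Real.Gamma_add_one hsum.ne', mul_div_mul_comm]

/-- The Bradley–Terry–Luce preference probability `θ i / (θ i + θ j)` has Dirichlet mean
`β i / (β i + β j)`. -/
theorem simplexIntegral_preference_mul_dirDensity {n : ℕ} {β : Fin (n + 1) → ℝ}
    (hβ : ∀ k, 0 < β k) {i j : Fin (n + 1)} (hij : i ≠ j) :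
    simplexIntegral (n + 1) (fun θ => θ i / (θ i + θ j) * dirDensity β θ) =
      β i / (β i + β j) * simplexIntegral (n + 1) (dirDensity β) := by
  have hi : (β + Pi.single i 1 : Fin (n + 1) → ℝ) i + (β + Pi.single i 1 : Fin (n + 1) → ℝ) j =
      β i + β j + 1 := by
    simp [hij.symm]
    ring
  rw [simplexIntegral_congr (g := fun θ => dirDensity (β + Pi.single i 1) θ / (θ i + θ j))
      fun θ hθ => by rw [dirDensity_add_single β i hθ, div_mul_eq_mul_div],
    simplexIntegral_dirDensity_div (add_single_pos hβ i) hij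
      (by rw [hi]; linarith [hβ i, hβ j]),
    simplexIntegral_dirDensity hβ, prod_Gamma_add_single hβ, sum_add_single, hi,
    add_sub_cancel_right, add_sub_cancel_right, mul_div_mul_comm]

theorem simplexIntegral_sq_mul_preference_mul_dirDensity {n : ℕ} {α : Fin (n + 1) → ℝ}
    (hα : ∀ k, 0 < α k) {i j : Fin (n + 1)} (hij : i ≠ j) (k : Fin (n + 1)) :
    simplexIntegral (n + 1) (fun θ => θ k ^ 2 * (θ i / (θ i + θ j)) * dirDensity α θ) =
      (α + Pi.single k 1 + Pi.single k 1 : Fin (n + 1) → ℝ) i /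
        ((α + Pi.single k 1 + Pi.single k 1 : Fin (n + 1) → ℝ) i +
          (α + Pi.single k 1 + Pi.single k 1 : Fin (n + 1) → ℝ) j) *
      ((α k + 1) / (∑ l, α l + 1) *
        (α k / (∑ l, α l) * simplexIntegral (n + 1) (dirDensity α))) := by
  have h₁ := add_single_pos hα k
  rw [simplexIntegral_congr (g := fun θ => θ i / (θ i + θ j) *
      dirDensity (α + Pi.single k 1 + Pi.single k 1) θ) fun θ hθ => by
        rw [dirDensity_add_single _ k hθ, dirDensity_add_single _ k hθ]; ring,
    simplexIntegral_preference_mul_dirDensity (add_single_pos h₁ k) hij,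
    simplexIntegral_dirDensity_add_single h₁, simplexIntegral_dirDensity_add_single hα,
    sum_add_single]
  simp

/-- Posterior second moments after one Bradley–Terry–Luce comparison where `i`
beats `j`, under a Dirichlet(α) prior. -/
theorem dirichlet_posterior_second_moments (K : ℕ) (hK : 2 ≤ K) (α : Fin K → ℝ)
    (hα : ∀ k, 0 < α k) (i j : Fin K) (hij : i ≠ j) :
    (simplexIntegral K (fun θ => θ i ^ 2 * (θ i / (θ i + θ j)) * dirDensity α θ)
      = (α i * (α i + 1) * (α i + 2)
          / ((∑ k, α k) * ((∑ k, α k) + 1) * (α i + α j + 2)))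
        * simplexIntegral K (fun θ => dirDensity α θ)) ∧
    (simplexIntegral K (fun θ => θ j ^ 2 * (θ i / (θ i + θ j)) * dirDensity α θ)
      = (α i * α j * (α j + 1)
          / ((∑ k, α k) * ((∑ k, α k) + 1) * (α i + α j + 2)))
        * simplexIntegral K (fun θ => dirDensity α θ)) ∧
    (∀ k : Fin K, k ≠ i → k ≠ j →
      simplexIntegral K (fun θ => θ k ^ 2 * (θ i / (θ i + θ j)) * dirDensity α θ)
        = (α k * (α k + 1) * α i
            / ((∑ k', α k') * ((∑ k', α k') + 1) * (α i + α j)))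
          * simplexIntegral K (fun θ => dirDensity α θ)) := by
  obtain ⟨n, rfl⟩ : ∃ n, K = n + 1 := ⟨K - 1, by omega⟩
  have hsum : 0 < ∑ k, α k := Finset.sum_pos (fun k _ => hα k) univ_nonempty
  have hi := hα i
  have hj := hα j
  refine ⟨?_, ?_, fun k hki hkj => ?_⟩
  · rw [simplexIntegral_sq_mul_preference_mul_dirDensity hα hij]
    simp only [Pi.add_apply, Pi.single_eq_same, Pi.single_eq_of_ne hij.symm]
    field_simp
    ring
  · rw [simplexIntegral_sq_mul_preference_mul_dirDensity hα hij]
    simp only [Pi.add_apply, Pi.single_eq_same, Pi.single_eq_of_ne hij]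
    field_simp
    ring
  · rw [simplexIntegral_sq_mul_preference_mul_dirDensity hα hij]
    simp only [Pi.add_apply, Pi.single_eq_of_ne hki.symm, Pi.single_eq_of_ne hkj.symm]
    field_simp
    ring
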